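/- Let α (micro states) and β (macro states) be types with additive commutative group structures on β, let F : α → α (fine propagator), C : β → β (coarse propagator), R : α → β (restriction), M : β → α → α (matching), and L : β → α (lifting) be maps. Assume R (M ρ U) = ρ for all ρ, U; M (R U) U = U for all U; and R (L ρ) = ρ for all ρ. Fix ρ₀ ∈ β and U₀ = L ρ₀. Define the micro-macro Parareal iterates by: ρ k 0 = ρ₀ and U k 0 = U₀ for all k; ρ 0 (n+1) = C (ρ 0 n) and U 0 (n+1) = L (ρ 0 (n+1)); ρ (k+1) (n+1) = C (ρ (k+1) n) + R (F (U k n)) - C (ρ k n) and U (k+1) (n+1) = M (ρ (k+1) (n+1)) (F (U k n)). Define the reference trajectory Uref 0 = U₀, Uref (n+1) = F (Uref n). Then the finite-termination property holds: U k n = Uref n for all k ≥ n. -/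

import Mathlib

/-- Finite-termination property of micro-macro Parareal. -/
theorem micro_macro_parareal_finite_termination {α β : Type*} [AddCommGroup β]
    (F : α → α) (C : β → β) (R : α → β) (M : β → α → α) (L : β → α)
    (hM : ∀ (ρ : β) (U : α), R (M ρ U) = ρ)
    (hMR : ∀ U : α, M (R U) U = U)
    (hL : ∀ ρ : β, R (L ρ) = ρ)
    (ρ₀ : β) (U₀ : α) (hU₀ : U₀ = L ρ₀)
    (ρ : ℕ → ℕ → β) (U : ℕ → ℕ → α)
    (hρ0 : ∀ k, ρ k 0 = ρ₀)
    (hU0 : ∀ k, U k 0 = U₀)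
    (hρz : ∀ n, ρ 0 (n + 1) = C (ρ 0 n))
    (hUz : ∀ n, U 0 (n + 1) = L (ρ 0 (n + 1)))
    (hρs : ∀ k n, ρ (k + 1) (n + 1) = C (ρ (k + 1) n) + R (F (U k n)) - C (ρ k n))
    (hUs : ∀ k n, U (k + 1) (n + 1) = M (ρ (k + 1) (n + 1)) (F (U k n)))
    (Uref : ℕ → α)
    (href0 : Uref 0 = U₀)
    (hrefs : ∀ n, Uref (n + 1) = F (Uref n)) :
    ∀ k n, n ≤ k → U k n = Uref n := by
  suffices h : ∀ n k, n ≤ k → U k n = Uref n ∧ ρ k n = R (Uref n) from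
    fun k n hn => (h n k hn).1
  intro n
  induction n with
  | zero =>
    intro k _
    exact ⟨by rw [hU0, href0], by rw [hρ0, href0, hU₀, hL]⟩
  | succ n ih =>
    rintro (_ | k) hk
    · omega
    · have hn : n ≤ k := Nat.le_of_succ_le_succ hk
      obtain ⟨hU, hρ⟩ := ih k hn
      have hρ' : ρ (k + 1) (n + 1) = R (Uref (n + 1)) := by
        rw [hρs, (ih (k + 1) (hn.trans k.le_succ)).2, hρ, hU, hrefs, add_sub_cancel_left]
      exact ⟨by rw [hUs, hρ', hU, ← hrefs, hMR], hρ'⟩
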